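/- arXiv:2407.14653 — 3 statements merged into one kernel-verified Lean document; each statement's English description precedes it below -/
import Mathlib

section
/- Let S and A be finite types, let γ ∈ (0,1), and let c : S × A → ℝ satisfy 0 ≤ c(s,a) ≤ Cmax for all (s,a), with Cmax ≥ 0. Let m₁, m₂ : S → ℝ be probability mass functions on S and k₁, k₂ : S → A → ℝ be stochastic kernels (each k_i s a probability mass function on A). Define the joint distributions d_i(s,a) := m_i s · k_i s a and the discounted values V_i := (1/(1−γ)) · ∑_{(s,a)} d_i(s,a) · c(s,a). Then |V₁ − V₂| ≤ (2·Cmax/(1−γ)) · TV(m₁, m₂) + (2·Cmax/(1−γ)) · ∑_s m₂ s · TV(k₁ s, k₂ s). -/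
noncomputable def TV {X : Type*} [Fintype X] (p q : X → ℝ) : ℝ :=
  (1 / 2) * ∑ x, |p x - q x|

/-- The L¹ distance of two joint distributions is at most that of the marginals plus the
averaged L¹ distance of the kernels. -/
theorem sum_abs_mul_kernel_sub_le {S A : Type*} [Fintype S] [Fintype A]
    (m₁ m₂ : S → ℝ) (k₁ k₂ : S → A → ℝ) (hm₂0 : ∀ s, 0 ≤ m₂ s)
    (hk₁0 : ∀ s a, 0 ≤ k₁ s a) (hk₁1 : ∀ s, ∑ a, k₁ s a = 1) :
    ∑ x : S × A, |m₁ x.1 * k₁ x.1 x.2 - m₂ x.1 * k₂ x.1 x.2|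
      ≤ ∑ s, |m₁ s - m₂ s| + ∑ s, m₂ s * ∑ a, |k₁ s a - k₂ s a| := by
  rw [Fintype.sum_prod_type, ← Finset.sum_add_distrib]
  refine Finset.sum_le_sum fun s _ => ?_
  calc ∑ a, |m₁ s * k₁ s a - m₂ s * k₂ s a|
      ≤ ∑ a, (|m₁ s - m₂ s| * k₁ s a + m₂ s * |k₁ s a - k₂ s a|) := by
        refine Finset.sum_le_sum fun a _ => ?_
        have h := abs_add_le ((m₁ s - m₂ s) * k₁ s a) (m₂ s * (k₁ s a - k₂ s a))
        rw [abs_mul, abs_mul, abs_of_nonneg (hk₁0 s a), abs_of_nonneg (hm₂0 s)] at h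
        rwa [show (m₁ s - m₂ s) * k₁ s a + m₂ s * (k₁ s a - k₂ s a)
          = m₁ s * k₁ s a - m₂ s * k₂ s a by ring] at h
    _ = |m₁ s - m₂ s| + m₂ s * ∑ a, |k₁ s a - k₂ s a| := by
        rw [Finset.sum_add_distrib, ← Finset.mul_sum, ← Finset.mul_sum, hk₁1, mul_one]

/-- Expectations of a function bounded by `C` differ by at most `C` times the L¹ distance. -/
theorem abs_sum_mul_sub_sum_mul_le {X : Type*} [Fintype X] (p q c : X → ℝ) (C : ℝ)
    (hc : ∀ x, |c x| ≤ C) :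
    |∑ x, p x * c x - ∑ x, q x * c x| ≤ C * ∑ x, |p x - q x| := by
  rw [← Finset.sum_sub_distrib, Finset.mul_sum]
  refine (Finset.abs_sum_le_sum_abs _ _).trans (Finset.sum_le_sum fun x _ => ?_)
  rw [← sub_mul, abs_mul, mul_comm]
  exact mul_le_mul_of_nonneg_right (hc x) (abs_nonneg _)

theorem performance_gap_lemma {S A : Type*} [Fintype S] [Fintype A]
    (γ : ℝ) (hγ0 : 0 < γ) (hγ1 : γ < 1)
    (c : S × A → ℝ) (Cmax : ℝ) (hCmax : 0 ≤ Cmax)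
    (hc0 : ∀ x, 0 ≤ c x) (hc1 : ∀ x, c x ≤ Cmax)
    (m₁ m₂ : S → ℝ) (k₁ k₂ : S → A → ℝ)
    (hm₁0 : ∀ s, 0 ≤ m₁ s) (hm₁1 : ∑ s, m₁ s = 1)
    (hm₂0 : ∀ s, 0 ≤ m₂ s) (hm₂1 : ∑ s, m₂ s = 1)
    (hk₁0 : ∀ s a, 0 ≤ k₁ s a) (hk₁1 : ∀ s, ∑ a, k₁ s a = 1)
    (hk₂0 : ∀ s a, 0 ≤ k₂ s a) (hk₂1 : ∀ s, ∑ a, k₂ s a = 1) :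
    |(1 / (1 - γ)) * (∑ x : S × A, (m₁ x.1 * k₁ x.1 x.2) * c x)
        - (1 / (1 - γ)) * (∑ x : S × A, (m₂ x.1 * k₂ x.1 x.2) * c x)|
      ≤ (2 * Cmax / (1 - γ)) * TV m₁ m₂
        + (2 * Cmax / (1 - γ)) * ∑ s, m₂ s * TV (k₁ s) (k₂ s) := by
  have hpos : 0 ≤ 1 / (1 - γ) := one_div_nonneg.mpr (sub_nonneg.mpr hγ1.le)
  have hTV : ∑ s, m₂ s * TV (k₁ s) (k₂ s) = 1 / 2 * ∑ s, m₂ s * ∑ a, |k₁ s a - k₂ s a| := by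
    simp only [TV, Finset.mul_sum, mul_left_comm]
  rw [← mul_sub, abs_mul, abs_of_nonneg hpos, hTV, TV]
  calc _ ≤ 1 / (1 - γ) * (Cmax * (∑ s, |m₁ s - m₂ s| + ∑ s, m₂ s * ∑ a, |k₁ s a - k₂ s a|)) :=
        mul_le_mul_of_nonneg_left
          ((abs_sum_mul_sub_sum_mul_le _ _ c Cmax fun x =>
              (abs_of_nonneg (hc0 x)).trans_le (hc1 x)).trans
            (mul_le_mul_of_nonneg_left
              (sum_abs_mul_kernel_sub_le m₁ m₂ k₁ k₂ hm₂0 hk₁0 hk₁1) hCmax))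
          hpos
    _ = _ := by ring
end

section
/- Let S and A be finite types. Let m_g, m⋆ : S → ℝ be probability mass functions on S and π_g, π⋆ : S → A → ℝ be stochastic kernels (each π s a probability mass function on A). Assume: (i) TV(m_g, m⋆) ≤ ε_state; (ii) for every s with m⋆ s > 0 and every a, π⋆ s a = 0 implies π_g s a = 0, and ∑_s m⋆ s · KL(π_g s, π⋆ s) ≤ ε_inv, where ε_state, ε_inv ≥ 0. Define the joint distributions d_g(s,a) := m_g s · π_g s a and d⋆(s,a) := m⋆ s · π⋆ s a. Then TV(d_g, d⋆) ≤ ε_state + √(ε_inv / 2). -/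
noncomputable def KL {X : Type*} [Fintype X] (p q : X → ℝ) : ℝ :=
  ∑ x, if 0 < p x then p x * Real.log (p x / q x) else 0

theorem two_mul_sub_one_le_add_one_mul_log {t : ℝ} (ht : 1 ≤ t) :
    2 * (t - 1) ≤ (t + 1) * Real.log t := by
  have h := Real.le_log_one_add_of_nonneg (sub_nonneg.2 ht)
  rw [div_le_iff₀ (by linarith), add_sub_cancel] at h
  linarith

theorem add_one_mul_log_le_two_mul_sub_one {t : ℝ} (h0 : 0 < t) (ht : t ≤ 1) :
    (t + 1) * Real.log t ≤ 2 * (t - 1) := by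
  have h := two_mul_sub_one_le_add_one_mul_log ((one_le_inv₀ h0).2 ht)
  rw [Real.log_inv] at h
  have h2 := mul_le_mul_of_nonneg_left h h0.le
  have e : t * t⁻¹ = 1 := mul_inv_cancel₀ h0.ne'
  have e1 : t * (2 * (t⁻¹ - 1)) = 2 * (1 - t) := by linear_combination 2 * e
  have e2 : t * ((t⁻¹ + 1) * -Real.log t) = -((t + 1) * Real.log t) := by
    linear_combination (-Real.log t) * e
  linarith

theorem three_mul_sub_one_sq_le {t : ℝ} (h0 : 0 < t) :
    3 * (t - 1) ^ 2 ≤ (2 * t + 4) * (t * Real.log t - t + 1) := by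
  let h : ℝ → ℝ := fun x => (2 * x + 4) * (x * Real.log x - x + 1) - 3 * (x - 1) ^ 2
  have hd : ∀ x : ℝ, 0 < x →
      HasDerivAt h (4 * ((x + 1) * Real.log x - 2 * (x - 1))) x := by
    intro x hx
    have h1 : HasDerivAt (fun x : ℝ => 2 * x + 4) 2 x := by
      simpa using ((hasDerivAt_id x).const_mul 2).add_const 4
    have h2 : HasDerivAt (fun x : ℝ => x * Real.log x - x + 1) (Real.log x + 1 - 1) x :=
      ((Real.hasDerivAt_mul_log hx.ne').sub (hasDerivAt_id x)).add_const 1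
    have h3 : HasDerivAt (fun x : ℝ => 3 * (x - 1) ^ 2) (3 * (2 * (x - 1))) x := by
      simpa using (((hasDerivAt_id x).sub_const 1).pow 2).const_mul 3
    exact ((h1.mul h2).sub h3).congr_deriv (by ring)
  have h1 : h 1 = 0 := by simp [h]
  suffices 0 ≤ h t from sub_nonneg.1 this
  rw [← h1]
  rcases le_total t 1 with ht | ht
  · have hanti : AntitoneOn h (Set.Ioc 0 1) := by
      apply antitoneOn_of_deriv_nonpos (convex_Ioc 0 1)
      · exact fun x hx => (hd x hx.1).continuousAt.continuousWithinAt
      · exact fun x hx =>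
          (hd x (interior_subset hx).1).differentiableAt.differentiableWithinAt
      · intro x hx
        have hx' := interior_subset hx
        rw [(hd x hx'.1).deriv]
        linarith [add_one_mul_log_le_two_mul_sub_one hx'.1 hx'.2]
    exact hanti ⟨h0, ht⟩ ⟨one_pos, le_rfl⟩ ht
  · have hpos : ∀ x ∈ Set.Ici (1 : ℝ), 0 < x := fun x hx => one_pos.trans_le hx
    have hmono : MonotoneOn h (Set.Ici 1) := by
      apply monotoneOn_of_deriv_nonneg (convex_Ici 1)
      · exact fun x hx => (hd x (hpos x hx)).continuousAt.continuousWithinAt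
      · exact fun x hx =>
          (hd x (hpos x (interior_subset hx))).differentiableAt.differentiableWithinAt
      · intro x hx
        have hx' := interior_subset hx
        rw [(hd x (hpos x hx')).deriv]
        linarith [two_mul_sub_one_le_add_one_mul_log hx']
    exact hmono Set.self_mem_Ici ht ht

theorem sub_le_mul_log_div {p q : ℝ} (hp : 0 < p) (hq : 0 < q) :
    p - q ≤ p * Real.log (p / q) := by
  have h := mul_le_mul_of_nonneg_left (Real.one_sub_inv_le_log_of_pos (div_pos hp hq)) hp.le
  have e : p * (1 - (p / q)⁻¹) = p - q := by field_simp
  linarith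

theorem three_mul_sub_sq_le {p q : ℝ} (hp : 0 < p) (hq : 0 < q) :
    3 * (p - q) ^ 2 ≤ (2 * p + 4 * q) * (p * Real.log (p / q) - p + q) := by
  have h := mul_le_mul_of_nonneg_left (three_mul_sub_one_sq_le (div_pos hp hq)) (sq_nonneg q)
  have e : q * (p / q) = p := mul_div_cancel₀ p hq.ne'
  generalize Real.log (p / q) = l at *
  generalize p / q = t at *
  subst e
  linarith

/-- **Pinsker's inequality** for probability mass functions on a finite type. -/
theorem TV_sq_le_KL_div_two {X : Type*} [Fintype X] {p q : X → ℝ}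
    (hp0 : ∀ x, 0 ≤ p x) (hp1 : ∑ x, p x = 1) (hq0 : ∀ x, 0 ≤ q x) (hq1 : ∑ x, q x = 1)
    (hac : ∀ x, q x = 0 → p x = 0) : TV p q ^ 2 ≤ KL p q / 2 := by
  have key : ∀ x, 0 ≤ (if 0 < p x then p x * Real.log (p x / q x) else 0) - p x + q x ∧
      |p x - q x| ^ 2 ≤ (2 * p x + 4 * q x) / 3 *
        ((if 0 < p x then p x * Real.log (p x / q x) else 0) - p x + q x) := by
    intro x
    rw [sq_abs]
    rcases (hp0 x).eq_or_lt' with hp | hp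
    · rw [if_neg hp.not_gt, hp]
      exact ⟨by linarith [hq0 x], by nlinarith [sq_nonneg (q x)]⟩
    · have hq : 0 < q x := (hq0 x).lt_of_ne' fun h => hp.ne' (hac x h)
      rw [if_pos hp]
      exact ⟨by linarith [sub_le_mul_log_div hp hq], by linarith [three_mul_sub_sq_le hp hq]⟩
  have h := Finset.sum_sq_le_sum_mul_sum_of_sq_le_mul Finset.univ
    (fun x _ => by linarith [hp0 x, hq0 x]) (fun x _ => (key x).1) (fun x _ => (key x).2)
  rw [← Finset.sum_div, Finset.sum_add_distrib, Finset.sum_add_distrib, Finset.sum_sub_distrib,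
    ← Finset.mul_sum, ← Finset.mul_sum, hp1, hq1] at h
  unfold TV KL
  linarith

theorem TV_joint_le {S A : Type*} [Fintype S] [Fintype A] {m n : S → ℝ} {π ρ : S → A → ℝ}
    (hn0 : ∀ s, 0 ≤ n s) (hπ0 : ∀ s a, 0 ≤ π s a) (hπ1 : ∀ s, ∑ a, π s a = 1) :
    TV (fun x : S × A => m x.1 * π x.1 x.2) (fun x : S × A => n x.1 * ρ x.1 x.2)
      ≤ TV m n + ∑ s, n s * TV (π s) (ρ s) := by
  have h : ∑ s, ∑ a, |m s * π s a - n s * ρ s a| ≤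
      ∑ s, (|m s - n s| + n s * ∑ a, |π s a - ρ s a|) := by
    refine Finset.sum_le_sum fun s _ => ?_
    calc ∑ a, |m s * π s a - n s * ρ s a|
        ≤ ∑ a, (|m s - n s| * π s a + n s * |π s a - ρ s a|) := by
          refine Finset.sum_le_sum fun a _ => ?_
          have e : m s * π s a - n s * ρ s a =
              (m s - n s) * π s a + n s * (π s a - ρ s a) := by ring
          rw [e]
          refine (abs_add_le _ _).trans_eq ?_
          rw [abs_mul, abs_mul, abs_of_nonneg (hπ0 s a), abs_of_nonneg (hn0 s)]
      _ = |m s - n s| + n s * ∑ a, |π s a - ρ s a| := by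
          rw [Finset.sum_add_distrib, ← Finset.mul_sum, ← Finset.mul_sum, hπ1, mul_one]
  rw [Finset.sum_add_distrib] at h
  simp only [TV, Fintype.sum_prod_type, mul_left_comm _ (1 / 2 : ℝ), ← Finset.mul_sum]
  linarith

theorem distribution_shaping_error_bound {S A : Type*} [Fintype S] [Fintype A]
    (mg mstar : S → ℝ) (πg πstar : S → A → ℝ)
    (εstate εinv : ℝ) (hεstate : 0 ≤ εstate) (hεinv : 0 ≤ εinv)
    (hmg0 : ∀ s, 0 ≤ mg s) (hmg1 : ∑ s, mg s = 1)
    (hms0 : ∀ s, 0 ≤ mstar s) (hms1 : ∑ s, mstar s = 1)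
    (hπg0 : ∀ s a, 0 ≤ πg s a) (hπg1 : ∀ s, ∑ a, πg s a = 1)
    (hπs0 : ∀ s a, 0 ≤ πstar s a) (hπs1 : ∀ s, ∑ a, πstar s a = 1)
    (hstate : TV mg mstar ≤ εstate)
    (hac : ∀ s, 0 < mstar s → ∀ a, πstar s a = 0 → πg s a = 0)
    (hinv : ∑ s, mstar s * KL (πg s) (πstar s) ≤ εinv) :
    TV (fun x : S × A => mg x.1 * πg x.1 x.2)
       (fun x : S × A => mstar x.1 * πstar x.1 x.2)
      ≤ εstate + Real.sqrt (εinv / 2) := by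
  refine (TV_joint_le hms0 hπg0 hπg1).trans (add_le_add hstate (Real.le_sqrt_of_sq_le ?_))
  have hpinsker : ∀ s, mstar s * TV (πg s) (πstar s) ^ 2 ≤
      mstar s * (KL (πg s) (πstar s) / 2) := by
    intro s
    rcases (hms0 s).eq_or_lt' with h | h
    · simp [h]
    · exact mul_le_mul_of_nonneg_left
        (TV_sq_le_KL_div_two (hπg0 s) (hπg1 s) (hπs0 s) (hπs1 s) (hac s h)) h.le
  calc (∑ s, mstar s * TV (πg s) (πstar s)) ^ 2
      ≤ (∑ s, mstar s) * ∑ s, mstar s * TV (πg s) (πstar s) ^ 2 :=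
        Finset.sum_sq_le_sum_mul_sum_of_sq_le_mul _ (fun s _ => hms0 s)
          (fun s _ => mul_nonneg (hms0 s) (sq_nonneg _)) (fun s _ => by apply le_of_eq; ring)
    _ ≤ ∑ s, mstar s * (KL (πg s) (πstar s) / 2) := by
        rw [hms1, one_mul]
        exact Finset.sum_le_sum fun s _ => hpinsker s
    _ = (∑ s, mstar s * KL (πg s) (πstar s)) / 2 := by
        simp only [Finset.sum_div, mul_div_assoc]
    _ ≤ εinv / 2 := by linarith
end

section
/- Let S and A be finite types, let γ ∈ (0,1), let c : S × A → ℝ satisfy 0 ≤ c(s,a) ≤ Cmax for all (s,a) with Cmax ≥ 0, and let κ ∈ ℝ. Let m, m⋆ : S → ℝ be probability mass functions on S and π, π_g, π⋆ : S → A → ℝ be stochastic kernels (each one, evaluated at any s, a probability mass function on A). Define V := (1/(1−γ)) · ∑_{(s,a)} m s · π s a · c(s,a) and V⋆ := (1/(1−γ)) · ∑_{(s,a)} m⋆ s · π⋆ s a · c(s,a). Assume: (i) V⋆ ≤ κ; (ii) TV(m, m⋆) ≤ ε_state; (iii) for every s with m⋆ s > 0 and every a, π_g s a = 0 implies π s a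 = 0, and ∑_s m⋆ s · KL(π s, π_g s) ≤ ε_reg; (iv) for every s with m⋆ s > 0 and every a, π⋆ s a = 0 implies π_g s a = 0, and ∑_s m⋆ s · KL(π_g s, π⋆ s) ≤ ε_inv, where ε_state, ε_reg, ε_inv ≥ 0. Then V − κ ≤ (2·Cmax/(1−γ)) · (ε_state + √(ε_inv / 2) + √(ε_reg / 2)). -/
/-- The squared Hellinger distance is at most the Kullback–Leibler divergence. -/
theorem sum_sq_sqrt_sub_sqrt_le_KL {X : Type*} [Fintype X] {p q : X → ℝ}
    (hp0 : ∀ x, 0 ≤ p x) (hq0 : ∀ x, 0 ≤ q x) (hpq : ∑ x, p x = ∑ x, q x)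
    (hac : ∀ x, q x = 0 → p x = 0) :
    ∑ x, (√(p x) - √(q x)) ^ 2 ≤ KL p q := by
  have key : ∀ x, p x - q x + (√(p x) - √(q x)) ^ 2 ≤
      if 0 < p x then p x * Real.log (p x / q x) else 0 := by
    intro x
    have hsp := Real.sq_sqrt (hp0 x)
    have hsq := Real.sq_sqrt (hq0 x)
    split_ifs with hp
    · have hq : 0 < q x := (hq0 x).lt_of_ne fun h => hp.ne' (hac x h.symm)
      have hsp0 := Real.sqrt_pos.2 hp
      have hsq0 := Real.sqrt_pos.2 hq
      have hlog : Real.log (p x / q x) = -2 * Real.log (√(q x) / √(p x)) := by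
        rw [Real.log_div hp.ne' hq.ne', Real.log_div hsq0.ne' hsp0.ne',
          Real.log_sqrt hp.le, Real.log_sqrt hq.le]
        ring
      have hle := mul_le_mul_of_nonneg_left
        (Real.log_le_sub_one_of_pos (div_pos hsq0 hsp0)) hp.le
      have hmul : p x * (√(q x) / √(p x)) = √(p x) * √(q x) := by
        nth_rewrite 1 [← hsp]
        field_simp
      rw [hlog]
      nlinarith
    · have hp' : p x = 0 := le_antisymm (not_lt.1 hp) (hp0 x)
      simp [hp', hsq]
  have h := Finset.sum_le_sum fun x (_ : x ∈ Finset.univ) => key x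
  rw [Finset.sum_add_distrib, Finset.sum_sub_distrib, hpq, sub_self, zero_add] at h
  exact h

/-- A Pinsker-type inequality for the `ℓ¹` distance. -/
theorem sq_sum_abs_sub_le_four_mul_KL {X : Type*} [Fintype X] {p q : X → ℝ}
    (hp0 : ∀ x, 0 ≤ p x) (hq0 : ∀ x, 0 ≤ q x)
    (hp1 : ∑ x, p x = 1) (hq1 : ∑ x, q x = 1) (hac : ∀ x, q x = 0 → p x = 0) :
    (∑ x, |p x - q x|) ^ 2 ≤ 4 * KL p q := by
  have hH := sum_sq_sqrt_sub_sqrt_le_KL hp0 hq0 (hp1.trans hq1.symm) hac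
  have hfac : ∀ x, |p x - q x| = |√(p x) - √(q x)| * (√(p x) + √(q x)) := by
    intro x
    rw [← abs_of_nonneg (add_nonneg (Real.sqrt_nonneg (p x)) (Real.sqrt_nonneg (q x))),
      ← abs_mul]
    congr 1
    linear_combination -Real.sq_sqrt (hp0 x) + Real.sq_sqrt (hq0 x)
  have hsum : ∑ x, (√(p x) + √(q x)) ^ 2 ≤ 4 := by
    calc ∑ x, (√(p x) + √(q x)) ^ 2 ≤ ∑ x, (2 * p x + 2 * q x) :=
          Finset.sum_le_sum fun x _ => by
            nlinarith [Real.sq_sqrt (hp0 x), Real.sq_sqrt (hq0 x),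
              sq_nonneg (√(p x) - √(q x))]
      _ = 4 := by
          rw [Finset.sum_add_distrib, ← Finset.mul_sum, ← Finset.mul_sum, hp1, hq1]
          norm_num
  calc (∑ x, |p x - q x|) ^ 2
      = (∑ x, |√(p x) - √(q x)| * (√(p x) + √(q x))) ^ 2 := by simp_rw [hfac]
    _ ≤ (∑ x, |√(p x) - √(q x)| ^ 2) * ∑ x, (√(p x) + √(q x)) ^ 2 :=
        Finset.sum_mul_sq_le_sq_mul_sq _ _ _
    _ = (∑ x, (√(p x) - √(q x)) ^ 2) * ∑ x, (√(p x) + √(q x)) ^ 2 := by simp_rw [sq_abs]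
    _ ≤ KL p q * 4 :=
        mul_le_mul hH hsum (Finset.sum_nonneg fun _ _ => sq_nonneg _)
          ((Finset.sum_nonneg fun _ _ => sq_nonneg _).trans hH)
    _ = 4 * KL p q := mul_comm _ _

/-- The averaged `ℓ¹` distance of two kernels is controlled by their averaged divergence. -/
theorem sum_mul_sum_abs_sub_le_four_mul_sqrt {S A : Type*} [Fintype S] [Fintype A]
    {w : S → ℝ} {p q : S → A → ℝ} {ε : ℝ}
    (hw0 : ∀ s, 0 ≤ w s) (hw1 : ∑ s, w s = 1)
    (hp0 : ∀ s a, 0 ≤ p s a) (hp1 : ∀ s, ∑ a, p s a = 1)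
    (hq0 : ∀ s a, 0 ≤ q s a) (hq1 : ∀ s, ∑ a, q s a = 1)
    (hac : ∀ s, 0 < w s → ∀ a, q s a = 0 → p s a = 0)
    (hKL : ∑ s, w s * KL (p s) (q s) ≤ ε) :
    ∑ s, w s * ∑ a, |p s a - q s a| ≤ 4 * √(ε / 2) := by
  have hterm : ∀ s, w s * (∑ a, |p s a - q s a|) ^ 2 ≤ 4 * (w s * KL (p s) (q s)) := by
    intro s
    rcases (hw0 s).eq_or_lt with h | h
    · simp [← h]
    · nlinarith [sq_sum_abs_sub_le_four_mul_KL (hp0 s) (hq0 s) (hp1 s) (hq1 s) (hac s h)]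
  have hsum : ∑ s, w s * (∑ a, |p s a - q s a|) ^ 2 ≤ 4 * ε := by
    refine (Finset.sum_le_sum fun s _ => hterm s).trans ?_
    rw [← Finset.mul_sum]
    linarith
  have hjensen : (∑ s, w s * ∑ a, |p s a - q s a|) ^ 2 ≤
      ∑ s, w s * (∑ a, |p s a - q s a|) ^ 2 := by
    simpa using (even_two.convexOn_pow (𝕜 := ℝ)).map_sum_le
      (fun s _ => hw0 s) hw1 (fun s _ => Set.mem_univ (∑ a, |p s a - q s a|))
  have hε : 0 ≤ ε := by
    have := Finset.sum_nonneg fun s (_ : s ∈ Finset.univ) =>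
      mul_nonneg (hw0 s) (sq_nonneg (∑ a, |p s a - q s a|))
    linarith
  refine abs_le_of_sq_le_sq' (?_ : _ ≤ (4 * √(ε / 2)) ^ 2) (by positivity) |>.2
  rw [mul_pow, Real.sq_sqrt (by positivity)]
  linarith

theorem constraint_violation_bound {S A : Type*} [Fintype S] [Fintype A]
    (γ : ℝ) (hγ0 : 0 < γ) (hγ1 : γ < 1)
    (c : S × A → ℝ) (Cmax : ℝ) (hCmax : 0 ≤ Cmax)
    (hc0 : ∀ x, 0 ≤ c x) (hc1 : ∀ x, c x ≤ Cmax)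
    (κ : ℝ)
    (m mstar : S → ℝ) (π πg πstar : S → A → ℝ)
    (εstate εreg εinv : ℝ)
    (hεstate : 0 ≤ εstate) (hεreg : 0 ≤ εreg) (hεinv : 0 ≤ εinv)
    (hm0 : ∀ s, 0 ≤ m s) (hm1 : ∑ s, m s = 1)
    (hms0 : ∀ s, 0 ≤ mstar s) (hms1 : ∑ s, mstar s = 1)
    (hπ0 : ∀ s a, 0 ≤ π s a) (hπ1 : ∀ s, ∑ a, π s a = 1)
    (hπg0 : ∀ s a, 0 ≤ πg s a) (hπg1 : ∀ s, ∑ a, πg s a = 1)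
    (hπs0 : ∀ s a, 0 ≤ πstar s a) (hπs1 : ∀ s, ∑ a, πstar s a = 1)
    (hVstar : (1 / (1 - γ)) * (∑ x : S × A, mstar x.1 * πstar x.1 x.2 * c x) ≤ κ)
    (hstate : TV m mstar ≤ εstate)
    (hac₁ : ∀ s, 0 < mstar s → ∀ a, πg s a = 0 → π s a = 0)
    (hreg : ∑ s, mstar s * KL (π s) (πg s) ≤ εreg)
    (hac₂ : ∀ s, 0 < mstar s → ∀ a, πstar s a = 0 → πg s a = 0)
    (hinv : ∑ s, mstar s * KL (πg s) (πstar s) ≤ εinv) :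
    (1 / (1 - γ)) * (∑ x : S × A, m x.1 * π x.1 x.2 * c x) - κ
      ≤ (2 * Cmax / (1 - γ)) * (εstate + Real.sqrt (εinv / 2) + Real.sqrt (εreg / 2)) := by
  have hγ : 0 < 1 - γ := sub_pos.2 hγ1
  have hdist : ∑ x : S × A, |m x.1 * π x.1 x.2 - mstar x.1 * πstar x.1 x.2| ≤
      2 * εstate + 4 * √(εreg / 2) + 4 * √(εinv / 2) := by
    have htri : ∀ s a, |m s * π s a - mstar s * πstar s a| ≤
        |m s - mstar s| * π s a + mstar s * |π s a - πg s a|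
          + mstar s * |πg s a - πstar s a| := by
      intro s a
      calc _ = |(m s - mstar s) * π s a + mstar s * (π s a - πg s a)
            + mstar s * (πg s a - πstar s a)| := by congr 1; ring
        _ ≤ _ := abs_add_three _ _ _
        _ = _ := by simp_rw [abs_mul, abs_of_nonneg (hπ0 s a), abs_of_nonneg (hms0 s)]
    have hR := sum_mul_sum_abs_sub_le_four_mul_sqrt hms0 hms1 hπ0 hπ1 hπg0 hπg1 hac₁ hreg
    have hI := sum_mul_sum_abs_sub_le_four_mul_sqrt hms0 hms1 hπg0 hπg1 hπs0 hπs1 hac₂ hinv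
    have hT : ∑ s, |m s - mstar s| ≤ 2 * εstate := by
      unfold TV at hstate
      linarith
    rw [Fintype.sum_prod_type]
    refine (Finset.sum_le_sum fun s _ => Finset.sum_le_sum fun a _ => htri s a).trans ?_
    simp_rw [Finset.sum_add_distrib, ← Finset.mul_sum, hπ1, mul_one]
    linarith
  have hP : ∑ x : S × A, m x.1 * π x.1 x.2 = 1 := by
    simp_rw [Fintype.sum_prod_type, ← Finset.mul_sum, hπ1, mul_one, hm1]
  have hQ : ∑ x : S × A, mstar x.1 * πstar x.1 x.2 = 1 := by
    simp_rw [Fintype.sum_prod_type, ← Finset.mul_sum, hπs1, mul_one, hms1]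
  -- Centering the cost at `Cmax / 2` does not change the difference and halves its range.
  have hcost : ∑ x : S × A, m x.1 * π x.1 x.2 * c x
      - ∑ x : S × A, mstar x.1 * πstar x.1 x.2 * c x ≤
      Cmax / 2 * ∑ x : S × A, |m x.1 * π x.1 x.2 - mstar x.1 * πstar x.1 x.2| := by
    calc _ = ∑ x : S × A, (m x.1 * π x.1 x.2 - mstar x.1 * πstar x.1 x.2) * (c x - Cmax / 2) := by
          simp_rw [sub_mul, mul_sub, Finset.sum_sub_distrib, ← Finset.sum_mul, hP, hQ]
          ring
      _ ≤ _ := by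
          rw [Finset.mul_sum]
          refine Finset.sum_le_sum fun x _ => (le_abs_self _).trans ?_
          rw [abs_mul, mul_comm]
          refine mul_le_mul_of_nonneg_right (abs_le.2 ⟨?_, ?_⟩) (abs_nonneg _) <;>
            linarith [hc0 x, hc1 x]
  have hgap : ∑ x : S × A, m x.1 * π x.1 x.2 * c x
      - ∑ x : S × A, mstar x.1 * πstar x.1 x.2 * c x ≤
      2 * Cmax * (εstate + √(εinv / 2) + √(εreg / 2)) := by
    nlinarith [mul_le_mul_of_nonneg_left hdist (div_nonneg hCmax zero_le_two), mul_nonneg hCmax hεstate]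
  have hscaled := mul_le_mul_of_nonneg_left hgap (one_div_nonneg.2 hγ.le)
  calc _ ≤ 1 / (1 - γ) * (∑ x : S × A, m x.1 * π x.1 x.2 * c x
        - ∑ x : S × A, mstar x.1 * πstar x.1 x.2 * c x) := by
        rw [mul_sub]
        linarith
    _ ≤ _ := hscaled
    _ = _ := by ring
end
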